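/- For every d with 1 ≤ d ≤ n, the number of closed walks of length d in the graph G(n, 312) of overlapping 312-avoiding permutations equals the central binomial coefficient binomial(2d, d). -/

import Mathlib

/-- A permutation avoids the pattern 312 if there are no indices
`i < j < k` with `π j < π k < π i`. -/
def Avoids312 {m : ℕ} (π : Equiv.Perm (Fin m)) : Prop :=
  ¬ ∃ i j k : Fin m, i < j ∧ j < k ∧ π j < π k ∧ π k < π i

/-- An edge of the graph `G(n, 312)` of overlapping 312-avoiding permutations:
a 312-avoiding permutation `σ ∈ S_{n+1}`; its tail is `Π(σ_1 ⋯ σ_n)` and its head is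
`Π(σ_2 ⋯ σ_{n+1})` (standardizations of the first resp. last `n` letters). -/
def Edge (n : ℕ) : Type := {σ : Equiv.Perm (Fin (n + 1)) // Avoids312 σ}

/-- `head σ = tail τ` in `G(n, 312)`: the standardization of the last `n` letters of `σ`
equals the standardization of the first `n` letters of `τ`, i.e. the last `n` letters of
`σ` and the first `n` letters of `τ` are in the same relative order. -/
def HeadEqTail {n : ℕ} (σ τ : Edge n) : Prop :=
  ∀ a b : Fin n, (σ.1 a.succ < σ.1 b.succ ↔ τ.1 a.castSucc < τ.1 b.castSucc)

/-- A closed walk of length `d` in `G(n, 312)`: a cyclic list `(e_1, …, e_d)` of edges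
with `head (e_i) = tail (e_{i+1})` (indices mod `d`). -/
def ClosedWalk (n d : ℕ) : Type :=
  {w : ZMod d → Edge n // ∀ i : ZMod d, HeadEqTail (w i) (w (i + 1))}

def GoodRel (n d : ℕ) (R : ℤ → ℤ → Prop) : Prop :=
  (∀ a c, R a c → a < c ∧ c ≤ a + n) ∧ (∀ a c, R (a + d) (c + d) ↔ R a c) ∧
  (∀ a b c, a < b → b < c → R a c → R b c) ∧
  (∀ a b c, R a b → R b c → c ≤ a + n → R a c)

def Par (R : ℤ → ℤ → Prop) (a c : ℤ) : Prop := R a c ∧ ∀ t, a < t → t < c → ¬ R a t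

open Classical in
noncomputable def childs (d : ℕ) (R : ℤ → ℤ → Prop) (c : ℤ) : Finset ℤ :=
  (Finset.Ico (c - d) c).filter (fun a => Par R a c)

theorem mem_childs {d : ℕ} {R : ℤ → ℤ → Prop} {c a : ℤ} :
    a ∈ childs d R c ↔ (c - d ≤ a ∧ a < c) ∧ Par R a c := by
  simp [childs]

theorem exists_pot (q : ℤ → ℕ) : ∃ H : ℤ → ℤ, ∀ t, H (t + 1) = H t + q (t + 1) - 1 := by
  refine ⟨fun t => ∑ i ∈ Finset.Ioc 0 t, ((q i : ℤ) - 1) - ∑ i ∈ Finset.Ioc t 0, ((q i : ℤ) - 1), ?_⟩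
  intro t
  simp only
  rcases lt_or_ge t 0 with h | h
  · have h1 : Finset.Ioc t 0 = insert (t + 1) (Finset.Ioc (t + 1) 0) := by
      ext x; simp; omega
    rw [h1, Finset.sum_insert (by simp), Finset.Ioc_eq_empty (a := 0) (b := t) (by omega),
      Finset.Ioc_eq_empty (a := 0) (b := t + 1) (by omega)]
    simp; ring
  · have h1 : Finset.Ioc 0 (t + 1) = insert (t + 1) (Finset.Ioc 0 t) := by
      ext x; simp; omega
    rw [h1, Finset.sum_insert (by simp), Finset.Ioc_eq_empty (a := t) (b := 0) (by omega),
      Finset.Ioc_eq_empty (a := t + 1) (b := 0) (by omega)]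
    simp; ring

noncomputable def pot (q : ℤ → ℕ) : ℤ → ℤ := (exists_pot q).choose
theorem pot_succ (q : ℤ → ℕ) (t : ℤ) : pot q (t + 1) = pot q t + q (t + 1) - 1 :=
  (exists_pot q).choose_spec t

theorem pot_sum (q : ℤ → ℕ) (a c : ℤ) (h : a ≤ c) :
    pot q c = pot q a + ((∑ i ∈ Finset.Ioc a c, q i : ℕ) : ℤ) - (c - a) := by
  induction c, h using Int.le_induction with
  | base => simp
  | succ c hc ih =>
    have h1 : Finset.Ioc a (c + 1) = insert (c + 1) (Finset.Ioc a c) := by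
      ext x; simp; omega
    rw [h1, Finset.sum_insert (by simp), pot_succ, ih]
    push_cast; ring

theorem sum_period (d : ℕ) [NeZero d] (p : ZMod d → ℕ) (t : ℤ) :
    ∑ i ∈ Finset.Ioc t (t + d), p (i : ZMod d) = ∑ i, p i := by
  have hd : (0 : ℤ) < d := by exact_mod_cast Nat.pos_of_ne_zero (NeZero.ne d)
  have hinj : Set.InjOn (fun i : ℤ => (i : ZMod d)) (Finset.Ioc t (t + d) : Finset ℤ) := by
    intro x hx y hy hxy
    simp only [Finset.coe_Ioc, Set.mem_Ioc] at hx hy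
    rw [ZMod.intCast_eq_intCast_iff_dvd_sub] at hxy
    obtain ⟨k, hk⟩ := hxy
    have h1 : k < 1 := by nlinarith
    have h2 : -1 < k := by nlinarith
    have : k = 0 := by omega
    subst this; simp at hk; omega
  have himg : (Finset.Ioc t (t + d)).image (fun i : ℤ => (i : ZMod d)) = Finset.univ := by
    apply Finset.eq_univ_of_card
    rw [Finset.card_image_of_injOn hinj]
    simp [ZMod.card]
  rw [← himg, Finset.sum_image hinj]

theorem pot_shift (d : ℕ) [NeZero d] (p : ZMod d → ℕ) (t : ℤ) :
    pot (fun i => p i) (t + d) = pot (fun i => p i) t + (∑ i, p i : ℕ) - d := by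
  have := pot_sum (fun i => p i) t (t + d) (by omega)
  rw [sum_period] at this
  rw [this]; ring

def relOf (n d : ℕ) (p : ZMod d → ℕ) (a c : ℤ) : Prop :=
  a < c ∧ c ≤ a + n ∧ ∀ b, a ≤ b → b < c → pot (fun i => p i) b ≤ pot (fun i => p i) c

theorem good_relOf (n d : ℕ) [NeZero d] (p : ZMod d → ℕ) : GoodRel n d (relOf n d p) := by
  refine ⟨fun a c h => ⟨h.1, h.2.1⟩, ?_, ?_, ?_⟩
  · intro a c
    constructor
    · rintro ⟨h1, h2, h3⟩
      refine ⟨by omega, by omega, fun b hb hc => ?_⟩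
      have := h3 (b + d) (by omega) (by omega)
      rw [pot_shift, pot_shift] at this
      omega
    · rintro ⟨h1, h2, h3⟩
      refine ⟨by omega, by omega, fun b hb hc => ?_⟩
      have := h3 (b - d) (by omega) (by omega)
      have e := pot_shift d p (b - d)
      rw [sub_add_cancel] at e
      rw [pot_shift]
      omega
  · rintro a b c hab hbc ⟨h1, h2, h3⟩
    exact ⟨hbc, by omega, fun x hx hc => h3 x (by omega) hc⟩
  · rintro a b c ⟨h1, h2, h3⟩ ⟨h4, h5, h6⟩ h
    refine ⟨by omega, h, fun x hx hc => ?_⟩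
    rcases lt_or_ge x b with hb | hb
    · exact (h3 x hx hb).trans (h6 b le_rfl h4)
    · exact h6 x hb hc

theorem card_childs_relOf (n d : ℕ) [NeZero d] (hdn : d ≤ n) (p : ZMod d → ℕ)
    (hp : ∑ i, p i ≤ d) (c : ℤ) : (childs d (relOf n d p) c).card = p c := by
  have hd : 0 < d := Nat.pos_of_ne_zero (NeZero.ne d)
  set H := pot (fun i => p i) with hH
  have hs : ∀ t, H (t + 1) = H t + p ((t + 1 : ℤ) : ZMod d) - 1 := pot_succ _
  have hc1 := hs (c - 1)
  rw [sub_add_cancel] at hc1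
  have hcd := pot_shift d p (c - d)
  rw [sub_add_cancel, ← hH] at hcd
  have key : ∀ a, a ∈ childs d (relOf n d p) c ↔
      (c - d ≤ a ∧ a < c) ∧ H a ≤ H c ∧ ∀ b, a < b → b < c → H b < H a := by
    intro a
    rw [mem_childs]
    refine and_congr_right fun ⟨h1, h2⟩ => ?_
    constructor
    · rintro ⟨⟨_, _, h3⟩, h4⟩
      refine ⟨h3 a le_rfl h2, ?_⟩
      have aux : ∀ k : ℕ, ∀ b, a < b → b < c → b ≤ a + k → H b < H a := by
        intro k
        induction k with
        | zero => intro b _ _ _; omega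
        | succ k ih =>
          intro b hb hbc hbk
          by_contra hcon
          apply h4 b hb hbc
          refine ⟨hb, by omega, fun x hx hxb => ?_⟩
          rcases eq_or_lt_of_le hx with rfl | hx
          · exact not_lt.mp hcon
          · have := ih x hx (by omega) (by push_cast at hbk; omega)
            change H x ≤ H b
            omega
      exact fun b hb hbc => aux d b hb hbc (by omega)
    · rintro ⟨h3, h4⟩
      refine ⟨⟨h2, by omega, fun b hb hbc => ?_⟩, ?_⟩
      · rcases eq_or_lt_of_le hb with rfl | hb
        · exact h3
        · exact (h4 b hb hbc).le.trans h3
      · rintro t ht htc ⟨_, _, h⟩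
        have h5 := h a le_rfl ht
        have h6 := h4 t ht htc
        rw [← hH] at h5
        omega
  have : (childs d (relOf n d p) c).card = (Finset.Icc (H (c - 1)) (H c)).card := by
    apply Finset.card_bij (fun a _ => H a)
    · intro a ha
      obtain ⟨⟨h1, h2⟩, h3, h4⟩ := (key a).1 ha
      rw [Finset.mem_Icc]
      refine ⟨?_, h3⟩
      rcases eq_or_lt_of_le (show a ≤ c - 1 by omega) with h | h
      · rw [h]
      · exact (h4 _ h (by omega)).le
    · intro a ha b hb hab
      obtain ⟨⟨h1, h2⟩, h3, h4⟩ := (key a).1 ha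
      obtain ⟨⟨h1', h2'⟩, h3', h4'⟩ := (key b).1 hb
      rcases lt_trichotomy a b with h | h | h
      · have := h4 b h h2'; omega
      · exact h
      · have := h4' a h h2; omega
    · intro h hh
      rw [Finset.mem_Icc] at hh
      obtain ⟨a, ⟨ha1, ha2, ha3⟩, ha4⟩ := Int.exists_greatest_of_bdd
        (P := fun a => c - d ≤ a ∧ a < c ∧ h ≤ H a) ⟨c, fun z hz => hz.2.1.le⟩
        ⟨c - d, le_rfl, by omega, by omega⟩
      have hlt : ∀ b, a < b → b < c → H b < h := by
        intro b hb hbc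
        by_contra hcon
        have := ha4 b ⟨by omega, hbc, not_lt.mp hcon⟩
        omega
      have hEq : H a = h := by
        rcases eq_or_lt_of_le (show a ≤ c - 1 by omega) with h' | h'
        · rw [h'] at ha3 ⊢; omega
        · have h1 := hlt (a + 1) (by omega) (by omega)
          have h2 := hs a
          omega
      refine ⟨a, (key a).2 ⟨⟨ha1, ha2⟩, by omega, fun b hb hbc => ?_⟩, hEq⟩
      rw [hEq]; exact hlt b hb hbc
  rw [this, Int.card_Icc]
  omega

section
variable {n d : ℕ} {R : ℤ → ℤ → Prop}

theorem par_unique {a c c' : ℤ} (hR : GoodRel n d R) (h : Par R a c) (h' : Par R a c') : c = c' := by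
  rcases lt_trichotomy c c' with h1 | h1 | h1
  · exact absurd h.1 (h'.2 c (hR.1 _ _ h.1).1 h1)
  · exact h1
  · exact absurd h'.1 (h.2 c' (hR.1 _ _ h'.1).1 h1)

theorem par_shift (hR : GoodRel n d R) (a c : ℤ) : Par R (a + d) (c + d) ↔ Par R a c := by
  unfold Par
  rw [hR.2.1]
  refine and_congr_right fun _ => ⟨fun h t h1 h2 h3 => ?_, fun h t h1 h2 h3 => ?_⟩
  · exact h (t + d) (by omega) (by omega) ((hR.2.1 _ _).2 h3)
  · refine h (t - d) (by omega) (by omega) ((hR.2.1 _ _).1 ?_)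
    rwa [sub_add_cancel]

theorem par_shift_mul (hR : GoodRel n d R) (a c k : ℤ) :
    Par R (a + d * k) (c + d * k) ↔ Par R a c := by
  induction k using Int.induction_on with
  | zero => simp
  | succ i ih => rw [← ih, ← par_shift hR (a + d * i)]; ring_nf
  | pred i ih => rw [← ih, ← par_shift hR (a + d * (-i - 1))]; ring_nf

theorem par_exists (hd : 0 < d) (hR : GoodRel n d R) {a c : ℤ} (h : R a c) :
    ∃ i, i ≤ c ∧ i - d ≤ a ∧ a < i ∧ Par R a i := by
  obtain ⟨i, h1, h2⟩ := Int.exists_least_of_bdd (P := fun t => R a t)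
    ⟨a, fun z hz => (hR.1 _ _ hz).1.le⟩ ⟨c, h⟩
  refine ⟨i, h2 c h, ?_, (hR.1 _ _ h1).1, h1, fun t _ ht ht' => ?_⟩
  · by_contra hcon
    have h3 := hR.2.2.1 a (a + d) i (by omega) (by omega) h1
    have h4 : R a (i - d) := by
      rw [← hR.2.1, sub_add_cancel]; exact h3
    have := h2 _ h4
    omega
  · have := h2 t ht'; omega

noncomputable def cnt (d : ℕ) (R : ℤ → ℤ → Prop) (i : ZMod d) : ℕ := (childs d R (i.cast : ℤ)).card

theorem childs_card_shift (hR : GoodRel n d R) (c k : ℤ) :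
    (childs d R (c + d * k)).card = (childs d R c).card := by
  symm
  apply Finset.card_bij (fun a _ => a + d * k)
  · intro a ha
    rw [mem_childs] at *
    rw [par_shift_mul hR]
    exact ⟨⟨by omega, by omega⟩, ha.2⟩
  · intro a _ b _ h; simpa using h
  · intro b hb
    refine ⟨b - d * k, ?_, by ring⟩
    rw [mem_childs] at *
    rw [← par_shift_mul hR _ _ k, sub_add_cancel]
    exact ⟨⟨by omega, by omega⟩, hb.2⟩

theorem cnt_cast (hR : GoodRel n d R) (c : ℤ) : cnt d R (c : ZMod d) = (childs d R c).card := by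
  have h : (((c : ZMod d).cast : ℤ) : ZMod d) = (c : ZMod d) := by simp
  rw [ZMod.intCast_eq_intCast_iff_dvd_sub] at h
  obtain ⟨k, hk⟩ := h
  unfold cnt
  rw [← childs_card_shift hR _ k, ← hk]
  congr 2; ring

theorem childs_disj (hR : GoodRel n d R) (s : Set ℤ) :
    s.PairwiseDisjoint (childs d R) := by
  intro i _ j _ hij
  rw [Function.onFun, Finset.disjoint_left]
  intro x hx hx'
  exact hij (par_unique hR (mem_childs.1 hx).2 (mem_childs.1 hx').2)

theorem cnt_sum_le [NeZero d] (hR : GoodRel n d R) : ∑ i, cnt d R i ≤ d := by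
  rw [← sum_period d (cnt d R) 0]
  simp only [cnt_cast hR]
  rw [← Finset.card_biUnion (childs_disj hR _)]
  have hd : 0 < d := Nat.pos_of_ne_zero (NeZero.ne d)
  calc _ ≤ (Finset.univ : Finset (ZMod d)).card := ?_
    _ = d := by simp [ZMod.card]
  apply Finset.card_le_card_of_injOn (fun x : ℤ => (x : ZMod d)) (by simp)
  intro x hx y hy hxy
  simp only [Finset.coe_biUnion, Set.mem_iUnion, Finset.mem_coe, Finset.mem_Ioc, mem_childs] at hx hy
  obtain ⟨i, ⟨hi1, hi2⟩, _, hi⟩ := hx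
  obtain ⟨j, ⟨hj1, hj2⟩, _, hj⟩ := hy
  simp only at hxy
  rw [ZMod.intCast_eq_intCast_iff_dvd_sub] at hxy
  obtain ⟨k, hk⟩ := hxy
  have h1 := (par_shift_mul hR x i k).2 hi
  rw [← hk, add_sub_cancel] at h1
  have h2 := par_unique hR hj h1
  have h3 : k < 1 := by nlinarith
  have h4 : -1 < k := by nlinarith
  have : k = 0 := by omega
  subst this; simp at hk; omega

theorem rel_eq [NeZero d] (hdn : d ≤ n) (hR : GoodRel n d R) : relOf n d (cnt d R) = R := by
  have hd : 0 < d := Nat.pos_of_ne_zero (NeZero.ne d)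
  set H := pot (fun i => cnt d R i) with hH
  have hsum : ∀ a c : ℤ, a ≤ c →
      H c = H a + (((Finset.Ioc a c).biUnion (childs d R)).card : ℤ) - (c - a) := by
    intro a c h
    rw [Finset.card_biUnion (childs_disj hR _), hH, pot_sum _ a c h]
    simp only [cnt_cast hR]
  have fwd : ∀ a c, R a c → H a ≤ H c := by
    intro a c h
    have hac := (hR.1 _ _ h).1
    rw [hsum a c hac.le]
    have : (Finset.Ico a c).card ≤ ((Finset.Ioc a c).biUnion (childs d R)).card := by
      apply Finset.card_le_card
      intro x hx
      rw [Finset.mem_Ico] at hx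
      have hxc : R x c := by
        rcases eq_or_lt_of_le hx.1 with h' | h'
        · rwa [← h']
        · exact hR.2.2.1 _ _ _ h' hx.2 h
      obtain ⟨i, h1, h2, h3, h4⟩ := par_exists hd hR hxc
      rw [Finset.mem_biUnion]
      exact ⟨i, Finset.mem_Ioc.2 ⟨by omega, h1⟩, mem_childs.2 ⟨⟨h2, h3⟩, h4⟩⟩
    rw [Int.card_Ico] at this
    omega
  funext a c
  apply propext
  constructor
  · rintro ⟨h1, h2, h3⟩
    by_contra hcon
    obtain ⟨b, ⟨hb1, hb2, hb3⟩, hb4⟩ := Int.exists_greatest_of_bdd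
      (P := fun b => a ≤ b ∧ b < c ∧ ¬ R b c) ⟨c, fun z hz => hz.2.1.le⟩ ⟨a, le_rfl, h1, hcon⟩
    have h4 := h3 b hb1 hb2
    rw [← hH, hsum b c hb2.le] at h4
    have : ((Finset.Ioc b c).biUnion (childs d R)).card ≤ (Finset.Ioo b c).card := by
      apply Finset.card_le_card
      intro x hx
      rw [Finset.mem_biUnion] at hx
      obtain ⟨i, hi, hx⟩ := hx
      rw [Finset.mem_Ioc] at hi
      obtain ⟨⟨hx1, hx2⟩, hx3, _⟩ := mem_childs.1 hx
      rw [Finset.mem_Ioo]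
      refine ⟨?_, by omega⟩
      by_contra hxb
      have hbi : R b i := by
        rcases eq_or_lt_of_le (not_lt.1 hxb) with h' | h'
        · rwa [← h']
        · exact hR.2.2.1 _ _ _ h' hi.1 hx3
      rcases eq_or_lt_of_le hi.2 with h' | h'
      · subst h'; exact hb3 hbi
      · have hic : R i c := by
          by_contra hn
          have := hb4 i ⟨by omega, h', hn⟩
          omega
        exact hb3 (hR.2.2.2 _ _ _ hbi hic (by omega))
    rw [Int.card_Ioo] at this
    omega
  · intro h
    obtain ⟨h1, h2⟩ := hR.1 _ _ h
    refine ⟨h1, h2, fun b hb hbc => ?_⟩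
    apply fwd
    rcases eq_or_lt_of_le hb with h' | h'
    · rwa [← h']
    · exact hR.2.2.1 _ _ _ h' hbc h
end

noncomputable def relEquiv (n d : ℕ) [NeZero d] (hdn : d ≤ n) :
    {R // GoodRel n d R} ≃ {p : ZMod d → ℕ // ∑ i, p i ≤ d} where
  toFun R := ⟨cnt d R.1, cnt_sum_le R.2⟩
  invFun p := ⟨relOf n d p.1, good_relOf n d p.1⟩
  left_inv R := Subtype.ext (rel_eq hdn R.2)
  right_inv p := by
    apply Subtype.ext
    funext i
    change (childs d (relOf n d p.1) _).card = p.1 i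
    rw [card_childs_relOf n d hdn p.1 p.2]
    simp

theorem card_p (d : ℕ) [NeZero d] :
    Nat.card {p : ZMod d → ℕ // ∑ i, p i ≤ d} = (2 * d).choose d := by
  let e : {p : ZMod d → ℕ // ∑ i, p i ≤ d} ≃ {P : Option (ZMod d) → ℕ // ∑ i, P i = d} :=
    { toFun := fun p => ⟨fun o => o.elim (d - ∑ i, p.1 i) p.1, by
        rw [Fintype.sum_option]; simpa using Nat.sub_add_cancel p.2⟩
      invFun := fun P => ⟨fun i => P.1 (some i), by
        have := P.2; rw [Fintype.sum_option] at this; dsimp only; omega⟩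
      left_inv := fun p => rfl
      right_inv := fun P => by
        apply Subtype.ext
        funext o
        have := P.2
        rw [Fintype.sum_option] at this
        cases o with
        | none => simp only [Option.elim]; omega
        | some i => rfl }
  rw [Nat.card_congr e, ← Nat.card_congr (Sym.equivNatSumOfFintype (Option (ZMod d)) d),
    Nat.card_eq_fintype_card, Sym.card_sym_eq_choose, Fintype.card_option, ZMod.card]
  congr 1; omega

theorem exists_perm {m : ℕ} (r : Fin m → Fin m → Prop) (hirr : ∀ x, ¬ r x x)
    (htr : ∀ x y z, r x y → r y z → r x z) (htot : ∀ x y, x ≠ y → r x y ∨ r y x) :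
    ∃ σ : Equiv.Perm (Fin m), ∀ x y, σ x < σ y ↔ r x y := by
  classical
  let f : Fin m → Fin m := fun x => ⟨(Finset.univ.filter (fun y => r y x)).card, by
    calc (Finset.univ.filter (fun y => r y x)).card < (Finset.univ : Finset (Fin m)).card :=
          Finset.card_lt_card (Finset.filter_ssubset.2 ⟨x, Finset.mem_univ _, (hirr x : ¬ r x x)⟩)
      _ = m := by simp⟩
  have hf : ∀ x y, r x y → f x < f y := by
    intro x y h
    change (Finset.univ.filter (fun z => r z x)).card < (Finset.univ.filter (fun z => r z y)).card
    apply Finset.card_lt_card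
    rw [Finset.ssubset_iff_of_subset]
    · exact ⟨x, by simpa using h, by simpa using hirr x⟩
    · intro z hz
      simp only [Finset.mem_filter, Finset.mem_univ, true_and] at *
      exact htr _ _ _ hz h
  have hinj : Function.Injective f := by
    intro x y h
    by_contra hxy
    rcases htot x y hxy with h' | h'
    · exact absurd h (hf _ _ h').ne
    · exact absurd h (hf _ _ h').ne'
  refine ⟨Equiv.ofBijective f (Finite.injective_iff_bijective.1 hinj), fun x y => ?_⟩
  rw [Equiv.ofBijective_apply, Equiv.ofBijective_apply]
  refine ⟨fun h => ?_, hf x y⟩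
  rcases eq_or_ne x y with rfl | hxy
  · exact absurd h (lt_irrefl _)
  · rcases htot x y hxy with h' | h'
    · exact h'
    · exact absurd h (hf _ _ h').asymm

theorem perm_ext_of_lt {m : ℕ} (σ τ : Equiv.Perm (Fin m))
    (h : ∀ x y, σ x < σ y ↔ τ x < τ y) : σ = τ := by
  have hm : StrictMono (σ.symm.trans τ) := by
    intro x y hxy
    simp only [Equiv.trans_apply]
    rw [← h]; simpa using hxy
  let e : Fin m ≃o Fin m := hm.orderIsoOfSurjective _ (σ.symm.trans τ).surjective
  have he : e = OrderIso.refl _ := Subsingleton.elim _ _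
  ext x
  have h1 : e (σ x) = σ x := by rw [he]; rfl
  have h2 : e (σ x) = τ x := by
    change (σ.symm.trans τ) (σ x) = τ x
    simp
  rw [← h1, h2]

section walks
variable {n d : ℕ}

theorem walk_shift (w : ClosedWalk n d) (j : ℕ) : ∀ (i : ZMod d) (x y : ℕ) (hx : x + j < n + 1)
    (hy : y + j < n + 1), ((w.1 i).1 ⟨x + j, hx⟩ < (w.1 i).1 ⟨y + j, hy⟩ ↔
      (w.1 (i + j)).1 ⟨x, by omega⟩ < (w.1 (i + j)).1 ⟨y, by omega⟩) := by
  induction j with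
  | zero => intro i x y hx hy; simp
  | succ j ih =>
    intro i x y hx hy
    have h1 := w.2 i ⟨x + j, by omega⟩ ⟨y + j, by omega⟩
    have h2 := ih (i + 1) x y (by omega) (by omega)
    have h3 : i + ((j + 1 : ℕ) : ZMod d) = i + 1 + j := by push_cast; ring
    rw [h3, ← h2]
    exact h1

def walkRel (w : ClosedWalk n d) (a c : ℤ) : Prop :=
  ∃ k : ℕ, ∃ hk : k < n + 1, 0 < k ∧ c = a + k ∧
    (w.1 (a : ZMod d)).1 ⟨k, hk⟩ < (w.1 (a : ZMod d)).1 ⟨0, by omega⟩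

theorem walkRel_iff (w : ClosedWalk n d) (s : ℤ) (x y : ℕ) (hxy : x < y) (hy : y < n + 1) :
    walkRel w (s + x) (s + y) ↔
      (w.1 (s : ZMod d)).1 ⟨y, hy⟩ < (w.1 (s : ZMod d)).1 ⟨x, by omega⟩ := by
  obtain ⟨k, rfl⟩ := Nat.exists_eq_add_of_lt hxy
  have h := walk_shift w x (s : ZMod d) (k + 1) 0 (by omega) (by omega)
  have e1 : (⟨k + 1 + x, by omega⟩ : Fin (n + 1)) = ⟨x + k + 1, hy⟩ := by ext; simp; omega
  have e2 : (⟨0 + x, by omega⟩ : Fin (n + 1)) = ⟨x, by omega⟩ := by ext; simp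
  have e3 : (s : ZMod d) + (x : ZMod d) = ((s + x : ℤ) : ZMod d) := by push_cast; rfl
  rw [e1, e2, e3] at h
  rw [h]
  constructor
  · rintro ⟨k', hk', _, hc, hlt⟩
    have : k' = k + 1 := by push_cast at hc; omega
    subst this
    exact hlt
  · intro hlt
    exact ⟨k + 1, by omega, by omega, by push_cast; ring, hlt⟩

theorem walkRel_good (w : ClosedWalk n d) : GoodRel n d (walkRel w) := by
  refine ⟨?_, ?_, ?_, ?_⟩
  · rintro a c ⟨k, hk, h0, rfl, _⟩
    omega
  · intro a c
    unfold walkRel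
    have : ((a + d : ℤ) : ZMod d) = (a : ZMod d) := by simp
    rw [this]
    refine exists_congr fun k => exists_congr fun hk => and_congr_right fun _ =>
      and_congr_left fun _ => ?_
    omega
  · intro a b c hab hbc h
    have h' := h
    obtain ⟨k, hk, h0, rfl, hlt⟩ := h'
    obtain ⟨x, rfl⟩ : ∃ x : ℕ, b = a + x := ⟨(b - a).toNat, by omega⟩
    rw [walkRel_iff w a x k (by omega) hk]
    by_contra hcon
    have hne : (w.1 (a : ZMod d)).1 ⟨x, by omega⟩ ≠ (w.1 (a : ZMod d)).1 ⟨k, hk⟩ := by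
      intro he
      have := (w.1 (a : ZMod d)).1.injective he
      simp at this; omega
    refine (w.1 (a : ZMod d)).2 ⟨⟨0, by omega⟩, ⟨x, by omega⟩, ⟨k, hk⟩, ?_, ?_, ?_, hlt⟩
    · rw [Fin.mk_lt_mk]; omega
    · rw [Fin.mk_lt_mk]; omega
    · exact lt_of_le_of_ne (not_lt.1 hcon) hne
  · rintro a b c ⟨k, hk, h0, rfl, hlt⟩ ⟨l, hl, h0', rfl, hlt'⟩ hn
    have h2 : walkRel w (a + k) (a + (k + l : ℕ)) := ⟨l, hl, h0', by push_cast; ring, hlt'⟩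
    rw [walkRel_iff w a k (k + l) (by omega) (by omega)] at h2
    exact ⟨k + l, by omega, by omega, by push_cast; ring, h2.trans hlt⟩

theorem walkRel_inj (w w' : ClosedWalk n d) (h : walkRel w = walkRel w') : w = w' := by
  apply Subtype.ext
  funext i
  apply Subtype.ext
  obtain ⟨s, rfl⟩ := ZMod.intCast_surjective i
  have key : ∀ x y : Fin (n + 1), x < y →
      ((w.1 (s : ZMod d)).1 y < (w.1 (s : ZMod d)).1 x ↔
        (w'.1 (s : ZMod d)).1 y < (w'.1 (s : ZMod d)).1 x) := by
    intro x y hxy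
    have h1 := walkRel_iff w s x y hxy y.2
    have h2 := walkRel_iff w' s x y hxy y.2
    rw [h] at h1
    exact h1.symm.trans h2
  apply perm_ext_of_lt
  intro x y
  rcases lt_trichotomy x y with hxy | hxy | hxy
  · have h1 := key x y hxy
    have n1 := (w.1 (s : ZMod d)).1.injective.ne hxy.ne
    have n2 := (w'.1 (s : ZMod d)).1.injective.ne hxy.ne
    constructor
    · intro h3
      exact lt_of_le_of_ne (not_lt.1 fun h4 => (h1.2 h4).asymm h3) n2
    · intro h3
      exact lt_of_le_of_ne (not_lt.1 fun h4 => (h1.1 h4).asymm h3) n1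
  · subst hxy; simp
  · exact key y x hxy

theorem good_shift_mul {R : ℤ → ℤ → Prop} (hR : GoodRel n d R) (a c k : ℤ) :
    R (a + d * k) (c + d * k) ↔ R a c := by
  induction k using Int.induction_on with
  | zero => simp
  | succ i ih => rw [← ih, ← hR.2.1 (a + d * i)]; ring_nf
  | pred i ih => rw [← ih, ← hR.2.1 (a + d * (-i - 1))]; ring_nf

def prec (R : ℤ → ℤ → Prop) (s : ℤ) (x y : ℕ) : Prop :=
  (x < y ∧ ¬ R (s + x) (s + y)) ∨ (y < x ∧ R (s + y) (s + x))

theorem prec_trans {R : ℤ → ℤ → Prop} (hR : GoodRel n d R) (s : ℤ) (x y z : ℕ)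
    (hx : x < n + 1) (hy : y < n + 1) (hz : z < n + 1)
    (h1 : prec R s x y) (h2 : prec R s y z) : prec R s x z := by
  obtain ⟨_, _, hm, ht⟩ := hR
  unfold prec at *
  have M : ∀ a b c : ℕ, a < b → b < c → R (s + a) (s + c) → R (s + b) (s + c) :=
    fun a b c h h' => hm _ _ _ (by omega) (by omega)
  have T : ∀ a b c : ℕ, c < n + 1 → R (s + a) (s + b) → R (s + b) (s + c) → R (s + a) (s + c) :=
    fun a b c h h1 h2 => ht _ _ _ h1 h2 (by omega)
  rcases h1 with ⟨h1, h1'⟩ | ⟨h1, h1'⟩ <;> rcases h2 with ⟨h2, h2'⟩ | ⟨h2, h2'⟩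
  · exact Or.inl ⟨by omega, fun h => h2' (M _ _ _ h1 h2 h)⟩
  · rcases lt_trichotomy x z with h | h | h
    · exact Or.inl ⟨h, fun h3 => h1' (T _ _ _ hy h3 h2')⟩
    · subst h; exact absurd h2' h1'
    · exact absurd (M _ _ _ h h1 h2') h1'
  · rcases lt_trichotomy x z with h | h | h
    · exact Or.inl ⟨h, fun h3 => h2' (T _ _ _ hz h1' h3)⟩
    · subst h; exact absurd h1' h2'
    · exact Or.inr ⟨h, M _ _ _ h2 h h1'⟩
  · exact Or.inr ⟨by omega, T _ _ _ hx h2' h1'⟩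

theorem walkRel_surj {R : ℤ → ℤ → Prop} (hR : GoodRel n d R) :
    ∃ w : ClosedWalk n d, walkRel w = R := by
  have hex : ∀ s : ℤ, ∃ σ : Equiv.Perm (Fin (n + 1)), ∀ x y, σ x < σ y ↔ prec R s x y := by
    intro s
    apply exists_perm (fun x y : Fin (n + 1) => prec R s x y)
    · intro x h
      unfold prec at h; omega
    · intro x y z; exact prec_trans hR s x y z x.2 y.2 z.2
    · intro x y hxy
      have : (x : ℕ) ≠ y := fun h => hxy (Fin.ext h)
      unfold prec
      rcases Nat.lt_or_gt_of_ne this with h | h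
      · by_cases h' : R (s + (x : ℕ)) (s + (y : ℕ))
        · exact Or.inr (Or.inr ⟨h, h'⟩)
        · exact Or.inl (Or.inl ⟨h, h'⟩)
      · by_cases h' : R (s + (y : ℕ)) (s + (x : ℕ))
        · exact Or.inl (Or.inr ⟨h, h'⟩)
        · exact Or.inr (Or.inl ⟨h, h'⟩)
  choose σ hσ using hex
  have hav : ∀ s, Avoids312 (σ s) := by
    rintro s ⟨i, j, k, hij, hjk, h1, h2⟩
    rw [hσ] at h1 h2
    have hij' : (i : ℕ) < j := hij
    have hjk' : (j : ℕ) < k := hjk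
    unfold prec at h1 h2
    have h3 : R (s + (i : ℕ)) (s + (k : ℕ)) := by
      rcases h2 with h | h
      · omega
      · exact h.2
    have h4 : ¬ R (s + (j : ℕ)) (s + (k : ℕ)) := by
      rcases h1 with h | h
      · exact h.2
      · omega
    exact h4 (hR.2.2.1 _ _ _ (by omega) (by omega) h3)
  have hper : ∀ (s t : ℤ) (x y : ℕ), (s : ZMod d) = t → (R (s + x) (s + y) ↔ R (t + x) (t + y)) := by
    intro s t x y h
    rw [ZMod.intCast_eq_intCast_iff_dvd_sub] at h
    obtain ⟨k, hk⟩ := h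
    rw [← good_shift_mul hR (s + x) _ k, ← hk]
    ring_nf
  let f : ZMod d → Edge n := fun i => ⟨σ (i.cast : ℤ), hav _⟩
  have hf : ∀ i, HeadEqTail (f i) (f (i + 1)) := by
    intro i a b
    change σ _ _ < σ _ _ ↔ σ _ _ < σ _ _
    rw [hσ, hσ]
    have aux : ∀ x y : ℕ, R ((i.cast : ℤ) + (x + 1 : ℕ)) ((i.cast : ℤ) + (y + 1 : ℕ)) ↔
        R (((i + 1).cast : ℤ) + x) (((i + 1).cast : ℤ) + y) := by
      intro x y
      rw [← hper ((i.cast : ℤ) + 1) ((i + 1).cast : ℤ) x y (by simp)]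
      push_cast
      ring_nf
    unfold prec
    simp only [Fin.val_succ, Fin.val_castSucc, aux, Nat.add_lt_add_iff_right]
  refine ⟨⟨f, hf⟩, ?_⟩
  have hmain : ∀ (a : ℤ) (k : ℕ) (hk : k < n + 1), 0 < k →
      ((f (a : ZMod d)).1 ⟨k, hk⟩ < (f (a : ZMod d)).1 ⟨0, by omega⟩ ↔ R a (a + k)) := by
    intro a k hk h0
    change σ _ _ < σ _ _ ↔ _
    rw [hσ]
    have := hper ((a : ZMod d).cast : ℤ) a 0 k (by simp)
    unfold prec
    simp only [this]
    simp [h0]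
  funext a c
  apply propext
  constructor
  · rintro ⟨k, hk, h0, rfl, h⟩
    exact (hmain a k hk h0).1 h
  · intro h
    obtain ⟨h1, h2⟩ := hR.1 _ _ h
    obtain ⟨k, rfl⟩ : ∃ k : ℕ, c = a + k := ⟨(c - a).toNat, by omega⟩
    exact ⟨k, by omega, by omega, rfl, (hmain a k (by omega) (by omega)).2 h⟩
end walks

/-- For `1 ≤ d ≤ n`, the number of closed walks of length `d` in `G(n, 312)` is the
central binomial coefficient `binomial (2d) d`. -/
theorem card_closed_walks (n d : ℕ) (hd : 1 ≤ d) (hdn : d ≤ n) :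
    Nat.card (ClosedWalk n d) = (2 * d).choose d := by
  haveI : NeZero d := ⟨by omega⟩
  have hbij : Function.Bijective
      (fun w : ClosedWalk n d => (⟨walkRel w, walkRel_good w⟩ : {R // GoodRel n d R})) := by
    constructor
    · intro w w' h
      exact walkRel_inj w w' (congrArg Subtype.val h)
    · rintro ⟨R, hR⟩
      obtain ⟨w, hw⟩ := walkRel_surj hR
      exact ⟨w, Subtype.ext hw⟩
  rw [Nat.card_eq_of_bijective _ hbij, Nat.card_congr (relEquiv n d hdn), card_p]
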